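/- arXiv:2008.12346 — 7 statements merged into one kernel-verified Lean document; each statement's English description precedes it below -/
import Mathlib

section
/- If F ⊆ ℤ₂^ω is a thin set, then Ego has no winning strategy in the Banach–Mazur game G(F); that is, for every Ego strategy e there exists an Alter strategy a such that Play(e,a) ∉ F. -/
/-- The Cantor cube `ℤ₂^ω`, modeled as infinite binary sequences. -/
abbrev Cantor := ℕ → Bool

/-- The (possibly infinite) Hamming distance between two infinite binary sequences. -/
noncomputable def hd (x y : Cantor) : ℕ∞ := {n : ℕ | x n ≠ y n}.encard

/-- `T` is thin: `hd x y ≥ 2` for all distinct `x, y ∈ T`. -/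
def IsThin (T : Set Cantor) : Prop := ∀ x ∈ T, ∀ y ∈ T, x ≠ y → 2 ≤ hd x y

/-- The relation `x ∼ y` iff `hd x y < ∞`. -/
def simRel (x y : Cantor) : Prop := hd x y < ⊤

/-- The `∼`-equivalence class of `x`. -/
def simClass (x : Cantor) : Set Cantor := {y | simRel x y}

/-- `ℤ₂⁺`: nonempty finite binary words. -/
abbrev Word := {l : List Bool // l ≠ []}

instance : Inhabited Word := ⟨⟨[false], by simp⟩⟩

/-- An Ego strategy: a function from finite (possibly empty) sequences of words to words. -/
abbrev EgoStrategy := List Word → Word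

/-- An Alter strategy: a function from nonempty finite sequences of words to words. -/
abbrev AlterStrategy := {l : List Word // l ≠ []} → Word

/-- `hist e a n = ([ε₀, …, ε_n], [α₁, …, α_n])`, the first moves of both players:
`ε₀ = e(∅)`, `α_i = a(ε₀,…,ε_{i-1})`, `ε_i = e(α₁,…,α_i)`. -/
def hist (e : EgoStrategy) (a : AlterStrategy) :
    ℕ → {p : List Word × List Word // p.1 ≠ []}
  | 0 => ⟨([e []], []), by simp⟩
  | n + 1 =>
    let p := hist e a n
    let α := a ⟨p.1.1, p.2⟩
    let ε := e (p.1.2 ++ [α])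
    ⟨(p.1.1 ++ [ε], p.1.2 ++ [α]), by simp⟩

/-- The `n`-th move of the play: the moves are `ε₀, α₁, ε₁, α₂, ε₂, …`. -/
def moveSeq (e : EgoStrategy) (a : AlterStrategy) (n : ℕ) : Word :=
  if n % 2 = 0 then ((hist e a (n / 2)).1.1).getLastD default
  else ((hist e a ((n + 1) / 2)).1.2).getLastD default

/-- `Play e a ∈ ℤ₂^ω` is the infinite concatenation `ε₀α₁ε₁α₂ε₂⋯`. -/
def Play (e : EgoStrategy) (a : AlterStrategy) : Cantor := fun n =>
  ((List.ofFn (fun i : Fin (n + 1) => (moveSeq e a i).1)).flatten).getD n false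

/-- The Alter strategy that plays the words of a fixed sequence, ignoring the moves of Ego. -/
def obliviousAlter (α : ℕ → Word) : AlterStrategy := fun l => α (l.1.length - 1)

theorem hist_obliviousAlter (e : EgoStrategy) (α : ℕ → Word) (n : ℕ) :
    (hist e (obliviousAlter α) n).1 =
      ((List.range (n + 1)).map fun k => e ((List.range k).map α), (List.range n).map α) := by
  induction n with
  | zero => simp [hist]
  | succ n ih =>
    rw [hist]
    simp only [ih, obliviousAlter]
    refine Prod.ext ?_ ?_ <;> simp [List.range_succ]

theorem moveSeq_obliviousAlter_even (e : EgoStrategy) (α : ℕ → Word) (k : ℕ) :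
    moveSeq e (obliviousAlter α) (2 * k) = e ((List.range k).map α) := by
  simp [moveSeq, hist_obliviousAlter, List.range_succ]

theorem moveSeq_obliviousAlter_odd (e : EgoStrategy) (α : ℕ → Word) (k : ℕ) :
    moveSeq e (obliviousAlter α) (2 * k + 1) = α k := by
  have h : (2 * k + 1 + 1) / 2 = k + 1 := by omega
  simp [moveSeq, hist_obliviousAlter, List.range_succ, h, Nat.add_mod]

/-- The concatenation of the first `n` words of a sequence. -/
def concatWords (w : ℕ → Word) : ℕ → List Bool
  | 0 => []
  | n + 1 => concatWords w n ++ (w n).1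

theorem le_length_concatWords (w : ℕ → Word) (n : ℕ) : n ≤ (concatWords w n).length := by
  induction n with
  | zero => simp
  | succ n ih =>
    have := List.length_pos_iff.mpr (w n).2
    simp only [concatWords, List.length_append]
    omega

theorem flatten_ofFn_eq_concatWords (w : ℕ → Word) (n : ℕ) :
    (List.ofFn fun i : Fin n => (w i).1).flatten = concatWords w n := by
  induction n with
  | zero => simp [concatWords]
  | succ n ih =>
    rw [List.ofFn_succ_last]
    simp [concatWords, ih]

theorem getD_concatWords_add (w : ℕ → Word) (n k : ℕ) :
    (concatWords w (n + 1 + k)).getD n false = (concatWords w (n + 1)).getD n false := by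
  induction k with
  | zero => rfl
  | succ k ih =>
    have := le_length_concatWords w (n + 1 + k)
    rw [← ih, ← add_assoc, concatWords, List.getD_append _ _ _ _ (by omega)]

theorem Play_eq_getD_concatWords (e : EgoStrategy) (a : AlterStrategy) (n k : ℕ) :
    Play e a n = (concatWords (moveSeq e a) (n + 1 + k)).getD n false := by
  rw [getD_concatWords_add, ← flatten_ofFn_eq_concatWords]
  rfl

/-- The words of Alter in two parallel plays against `e`: in the first play Alter starts with the
bit `0`, in the second one with the bit `1`, and afterwards Alter copies in each play the words of
Ego from the other one. -/
def mirrorHist (e : EgoStrategy) : ℕ → List Word × List Word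
  | 0 => ([⟨[false], by simp⟩], [⟨true :: (e [⟨[false], by simp⟩]).1, by simp⟩])
  | n + 1 =>
    let A := (mirrorHist e n).1
    let B := (mirrorHist e n).2
    (A ++ [e B], B ++ [e (A ++ [e B])])

theorem exists_mirror_sequences (e : EgoStrategy) :
    ∃ α β : ℕ → Word, (α 0).1 = [false] ∧ (β 0).1 = true :: (e ((List.range 1).map α)).1 ∧
      (∀ n, α (n + 1) = e ((List.range (n + 1)).map β)) ∧
      ∀ n, β (n + 1) = e ((List.range (n + 2)).map α) := by
  let α : ℕ → Word := fun n => (mirrorHist e n).1.getLastD default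
  let β : ℕ → Word := fun n => (mirrorHist e n).2.getLastD default
  have hP (n : ℕ) :
      mirrorHist e n = ((List.range (n + 1)).map α, (List.range (n + 1)).map β) := by
    induction n with
    | zero => simp [α, β, mirrorHist]
    | succ n ih =>
      have hA : (List.range (n + 1)).map α = (mirrorHist e n).1 := by rw [ih]
      have hB : (List.range (n + 1)).map β = (mirrorHist e n).2 := by rw [ih]
      rw [List.range_succ, List.map_append, List.map_append, hA, hB]
      simp [α, β, mirrorHist]
  refine ⟨α, β, rfl, rfl, fun n => ?_, fun n => ?_⟩
  · have : α (n + 1) = e (mirrorHist e n).2 := by simp [α, mirrorHist]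
    rw [this, hP]
  · have : β (n + 1) = e (mirrorHist e (n + 1)).1 := by simp [β, mirrorHist]
    rw [this, hP]

theorem concatWords_eq_of_shift {v w : ℕ → Word} (h0 : w 0 = v 0) (hv : (v 1).1 = [false])
    (hw : (w 1).1 = true :: (v 2).1) (h : ∀ m, w (m + 2) = v (m + 3)) (m : ℕ) :
    ∃ t, concatWords v (m + 3) = (v 0).1 ++ false :: t ∧
      concatWords w (m + 2) = (v 0).1 ++ true :: t := by
  induction m with
  | zero => exact ⟨(v 2).1, by simp [concatWords, hv], by simp [concatWords, h0, hw]⟩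
  | succ m ih =>
    obtain ⟨t, h₁, h₂⟩ := ih
    exact ⟨t ++ (v (m + 3)).1, by rw [concatWords, h₁]; simp,
      by rw [concatWords, h₂, h]; simp⟩

theorem getD_append_cons_ne_iff (u t : List Bool) (n : ℕ) :
    (u ++ false :: t).getD n false ≠ (u ++ true :: t).getD n false ↔ n = u.length := by
  rcases lt_trichotomy n u.length with h | rfl | h
  · simp [List.getElem?_append_left h, h.ne]
  · simp
  · obtain ⟨k, rfl⟩ := Nat.exists_eq_add_of_lt h
    simp [List.getElem?_append_right, Nat.add_assoc]

/-- Against every Ego strategy there are two plays that differ in exactly one position. -/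
theorem exists_hd_Play_eq_one (e : EgoStrategy) :
    ∃ a b : AlterStrategy, hd (Play e a) (Play e b) = 1 := by
  obtain ⟨α, β, hα, hβ, hα', hβ'⟩ := exists_mirror_sequences e
  refine ⟨obliviousAlter α, obliviousAlter β, ?_⟩
  set v := moveSeq e (obliviousAlter α) with hv
  set w := moveSeq e (obliviousAlter β) with hw
  have hshift (m : ℕ) : w (m + 2) = v (m + 3) := by
    obtain ⟨k, rfl | rfl⟩ := Nat.even_or_odd' m
    · rw [show 2 * k + 2 = 2 * (k + 1) by ring, show 2 * k + 3 = 2 * (k + 1) + 1 by ring,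
        hv, hw, moveSeq_obliviousAlter_even, moveSeq_obliviousAlter_odd, hα']
    · rw [show 2 * k + 1 + 2 = 2 * (k + 1) + 1 by ring, show 2 * k + 1 + 3 = 2 * (k + 2) by ring,
        hv, hw, moveSeq_obliviousAlter_even, moveSeq_obliviousAlter_odd, hβ']
  have hv0 : v 0 = e [] := moveSeq_obliviousAlter_even e α 0
  have hw0 : w 0 = e [] := moveSeq_obliviousAlter_even e β 0
  have hv1 : v 1 = α 0 := moveSeq_obliviousAlter_odd e α 0
  have hw1 : w 1 = β 0 := moveSeq_obliviousAlter_odd e β 0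
  have hv2 : v 2 = e ((List.range 1).map α) := moveSeq_obliviousAlter_even e α 1
  rw [hd, Set.encard_eq_one]
  refine ⟨(v 0).1.length, Set.ext fun n => ?_⟩
  obtain ⟨t, h₁, h₂⟩ := concatWords_eq_of_shift (hw0.trans hv0.symm) (by rw [hv1, hα])
    (by rw [hw1, hβ, hv2]) hshift n
  rw [Set.mem_ofPred_eq, Set.mem_singleton_iff, Play_eq_getD_concatWords e _ n 2,
    Play_eq_getD_concatWords e _ n 1, ← hv, ← hw, show n + 1 + 2 = n + 3 from rfl,
    show n + 1 + 1 = n + 2 from rfl, h₁, h₂, getD_append_cons_ne_iff]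

/-- Proposition 5: if `F` is thin, then Ego has no winning strategy in the
Banach–Mazur game `G(F)`. -/
theorem ego_no_winning_strategy_of_thin (F : Set Cantor) (hF : IsThin F) :
    ∀ e : EgoStrategy, ∃ a : AlterStrategy, Play e a ∉ F := by
  intro e
  by_contra! hwin
  obtain ⟨a, b, hab⟩ := exists_hd_Play_eq_one e
  have hne : Play e a ≠ Play e b := fun h => by simp [h, hd] at hab
  have h2 := hF _ (hwin a) _ (hwin b) hne
  rw [hab] at h2
  exact absurd h2 (by decide)
end

section
/- Let F ⊆ ℤ₂^ω be a set such that Alter has a winning strategy in the Banach–Mazur game G(F). Then there exists an equivalence class X of the relation ∼ such that X ∩ F = ∅. -/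
/-- The finite word `w` is an initial segment of the sequence `x`. -/
def IsInitial (w : List Bool) (x : Cantor) : Prop := ∀ i (h : i < w.length), w[i] = x i

lemma IsInitial.of_append {u v : List Bool} {x : Cantor} (h : IsInitial (u ++ v) x) :
    IsInitial u x := by
  intro i hi
  rw [← h i (by simp; omega), List.getElem_append_left hi]

lemma isClopen_setOf_isInitial (w : List Bool) : IsClopen {x : Cantor | IsInitial w x} := by
  have : {x : Cantor | IsInitial w x} =
      ⋂ i : Fin w.length, (fun x : Cantor => x i) ⁻¹' {w[i]} := by
    ext x
    simp only [IsInitial, Set.mem_ofPred_eq, Set.mem_iInter, Set.mem_preimage,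
      Set.mem_singleton_iff]
    exact ⟨fun h i => (h i i.2).symm, fun h i hi => (h ⟨i, hi⟩).symm⟩
  rw [this]
  exact isClopen_iInter_of_finite fun i => (isClopen_discrete _).preimage (continuous_apply _)

/-- The word built after Ego has played the moves in `t` (latest first) and Alter has answered
each of them according to `a`. -/
def position (a : AlterStrategy) : List Word → List Bool
  | [] => []
  | w :: t => position a t ++ w.1 ++ (a ⟨(w :: t).reverse, by simp⟩).1

/-- The sequences which, if they extend the position after `t`, also extend the position after
one more round. -/
def continuable (a : AlterStrategy) (t : List Word) : Set Cantor :=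
  {x | IsInitial (position a t) x → ∃ w, IsInitial (position a (w :: t)) x}

lemma isOpen_continuable (a : AlterStrategy) (t : List Word) : IsOpen (continuable a t) := by
  have : continuable a t = {x | IsInitial (position a t) x}ᶜ ∪
      ⋃ w, {x | IsInitial (position a (w :: t)) x} := by
    ext x
    simp [continuable, imp_iff_not_or]
  rw [this]
  exact (isClopen_setOf_isInitial _).compl.isOpen.union
    (isOpen_iUnion fun w => (isClopen_setOf_isInitial _).isOpen)

lemma dense_continuable (a : AlterStrategy) (t : List Word) : Dense (continuable a t) := by
  rw [(PiNat.isTopologicalBasis_cylinders (fun _ : ℕ => Bool)).dense_iff]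
  rintro _ ⟨x, n, rfl⟩ -
  by_cases hx : IsInitial (position a t) x
  · set p := position a t with hp
    let w : Word := ⟨List.ofFn fun i : Fin (n + 1) => x (p.length + i), by simp⟩
    refine ⟨fun i => (position a (w :: t)).getD i false, ?_, fun _ => ⟨w, ?_⟩⟩
    · rw [PiNat.mem_cylinder_iff]
      intro i hi
      simp only [position, ← hp]
      have hlen : w.1.length = n + 1 := by simp [w]
      rw [List.getD_append _ _ _ _ (by rw [List.length_append, hlen]; omega)]
      by_cases hip : i < p.length
      · rw [List.getD_append _ _ _ _ hip, List.getD_eq_getElem _ _ hip, hx i hip]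
      · rw [List.getD_append_right _ _ _ _ (by omega),
          List.getD_eq_getElem _ _ (by rw [hlen]; omega)]
        simp only [w, List.getElem_ofFn]
        congr 1
        omega
    · intro i hi
      simp [List.getElem?_eq_getElem hi]
  · exact ⟨x, PiNat.self_mem_cylinder x n, fun h => absurd h hx⟩

/-- The concatenation of the first `m` moves of a play. -/
def playSegment (e : EgoStrategy) (a : AlterStrategy) (m : ℕ) : List Bool :=
  (List.ofFn fun i : Fin m => (moveSeq e a i).1).flatten

lemma playSegment_succ (e : EgoStrategy) (a : AlterStrategy) (m : ℕ) :
    playSegment e a (m + 1) = playSegment e a m ++ (moveSeq e a m).1 := by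
  rw [playSegment, List.ofFn_succ_last]
  simp [playSegment]

lemma le_length_playSegment (e : EgoStrategy) (a : AlterStrategy) (m : ℕ) :
    m ≤ (playSegment e a m).length := by
  induction m with
  | zero => simp
  | succ m ih =>
    have := List.length_pos_iff.2 (moveSeq e a m).2
    rw [playSegment_succ, List.length_append]
    omega

lemma exists_playSegment_eq_append (e : EgoStrategy) (a : AlterStrategy) (m k : ℕ) :
    ∃ v, playSegment e a (m + k) = playSegment e a m ++ v := by
  induction k with
  | zero => exact ⟨[], by simp⟩
  | succ k ih =>
    obtain ⟨v, hv⟩ := ih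
    exact ⟨v ++ (moveSeq e a (m + k)).1, by
      rw [← Nat.add_assoc, playSegment_succ, hv, List.append_assoc]⟩

/-- Ego's first `n` moves, latest first, when each move is chosen by `f` from the previous ones. -/
def egoHistory (f : List Word → Word) : ℕ → List Word
  | 0 => []
  | n + 1 => f (egoHistory f n) :: egoHistory f n

/-- The Ego strategy choosing each move by `f` from Ego's own previous moves. -/
def egoOf (f : List Word → Word) : EgoStrategy := fun l => f (egoHistory f l.length)

lemma hist_egoOf (f : List Word → Word) (a : AlterStrategy) (n : ℕ) :
    (hist (egoOf f) a n).1.1 = (egoHistory f (n + 1)).reverse ∧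
      (hist (egoOf f) a n).1.2.length = n := by
  induction n with
  | zero => simp [hist, egoOf, egoHistory]
  | succ n ih =>
    obtain ⟨h1, h2⟩ := ih
    simp [hist, h1, h2, egoOf, egoHistory]

lemma playSegment_egoOf (f : List Word → Word) (a : AlterStrategy) (n : ℕ) :
    playSegment (egoOf f) a (2 * n) = position a (egoHistory f n) := by
  induction n with
  | zero => simp [playSegment, egoHistory, position]
  | succ n ih =>
    have hego : moveSeq (egoOf f) a (2 * n) = f (egoHistory f n) := by
      have h1 : 2 * n % 2 = 0 := by omega
      have h2 : 2 * n / 2 = n := by omega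
      rw [moveSeq, if_pos h1, h2, (hist_egoOf f a n).1]
      simp [egoHistory]
    have halter : moveSeq (egoOf f) a (2 * n + 1) =
        a ⟨(egoHistory f (n + 1)).reverse, by simp [egoHistory]⟩ := by
      have h1 : ¬ (2 * n + 1) % 2 = 0 := by omega
      have h2 : (2 * n + 1 + 1) / 2 = n + 1 := by omega
      rw [moveSeq, if_neg h1, h2]
      simp [hist, (hist_egoOf f a n).1]
    rw [show 2 * (n + 1) = 2 * n + 1 + 1 by ring, playSegment_succ, playSegment_succ, ih, hego,
      halter]
    rfl

lemma exists_play_eq {a : AlterStrategy} {x : Cantor} (hx : ∀ t, x ∈ continuable a t) :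
    ∃ e, Play e a = x := by
  have hx' : ∀ t, ∃ w, IsInitial (position a t) x → IsInitial (position a (w :: t)) x := by
    intro t
    by_cases ht : IsInitial (position a t) x
    · obtain ⟨w, hw⟩ := hx t ht
      exact ⟨w, fun _ => hw⟩
    · exact ⟨default, fun h => absurd h ht⟩
  choose f hf using hx'
  have hinit : ∀ n, IsInitial (position a (egoHistory f n)) x := by
    intro n
    induction n with
    | zero => exact fun i hi => absurd hi (by simp [egoHistory, position])
    | succ n ih => exact hf _ ih
  refine ⟨egoOf f, funext fun n => ?_⟩
  have hpre : IsInitial (playSegment (egoOf f) a (n + 1)) x := by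
    obtain ⟨v, hv⟩ := exists_playSegment_eq_append (egoOf f) a (n + 1) (n + 1)
    rw [← two_mul, playSegment_egoOf] at hv
    exact (hv ▸ hinit (n + 1)).of_append
  have hn : n < (playSegment (egoOf f) a (n + 1)).length :=
    le_length_playSegment (egoOf f) a (n + 1)
  exact (List.getD_eq_getElem _ _ hn).trans (hpre n hn)

/-- The homeomorphism of the Cantor cube flipping the coordinates in `s`. -/
def flipHomeomorph (s : Finset ℕ) : Cantor ≃ₜ Cantor where
  toFun x i := xor (x i) (decide (i ∈ s))
  invFun x i := xor (x i) (decide (i ∈ s))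
  left_inv x := by ext; simp
  right_inv x := by ext; simp
  continuous_toFun := continuous_pi fun i =>
    (continuous_of_discreteTopology (f := fun b => xor b (decide (i ∈ s)))).comp
      (continuous_apply i)
  continuous_invFun := continuous_pi fun i =>
    (continuous_of_discreteTopology (f := fun b => xor b (decide (i ∈ s)))).comp
      (continuous_apply i)

lemma simRel.exists_flipHomeomorph_eq {x y : Cantor} (h : simRel x y) :
    ∃ s, flipHomeomorph s x = y := by
  have hfin : {n | x n ≠ y n}.Finite := Set.encard_lt_top_iff.1 h
  refine ⟨hfin.toFinset, funext fun i => ?_⟩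
  change xor (x i) (decide (i ∈ hfin.toFinset)) = y i
  simp only [Set.Finite.mem_toFinset, Set.mem_ofPred_eq]
  generalize x i = b, y i = c
  cases b <;> cases c <;> simp

/-- Proposition 7: if Alter has a winning strategy in `G(F)`, then some
`∼`-equivalence class is disjoint from `F`. -/
theorem class_disjoint_of_alter_winning (F : Set Cantor)
    (h : ∃ a : AlterStrategy, ∀ e : EgoStrategy, Play e a ∉ F) :
    ∃ z : Cantor, simClass z ∩ F = ∅ := by
  obtain ⟨a, ha⟩ := h
  obtain ⟨z, hz⟩ := (dense_iInter_of_isOpen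
    (f := fun q : Finset ℕ × List Word => flipHomeomorph q.1 ⁻¹' continuable a q.2)
    (fun q => (isOpen_continuable a q.2).preimage (flipHomeomorph q.1).continuous)
    (fun q => (dense_continuable a q.2).preimage (flipHomeomorph q.1).isOpenMap)).nonempty
  rw [Set.mem_iInter] at hz
  refine ⟨z, Set.eq_empty_iff_forall_notMem.2 ?_⟩
  rintro y ⟨hy, hyF⟩
  obtain ⟨s, rfl⟩ := simRel.exists_flipHomeomorph_eq hy
  obtain ⟨e, he⟩ := exists_play_eq (x := flipHomeomorph s z) fun t => hz (s, t)
  exact ha e (he ▸ hyF)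
end

section
/- If T ⊆ ℤ₂^ω is a thin set such that T ∩ X ≠ ∅ for every equivalence class X of ∼, then T is not a Borel subset of the Cantor cube. -/
open MeasureTheory

open Filter Topology

/-- Flip the coordinates of `x` that belong to the finite set `F`. -/
def flipOn (F : Finset ℕ) (x : Cantor) : Cantor := fun n => xor (x n) (decide (n ∈ F))

lemma flipOn_involutive (F : Finset ℕ) : Function.Involutive (flipOn F) := by
  intro x
  funext n
  simp [flipOn]

lemma continuous_flipOn (F : Finset ℕ) : Continuous (flipOn F) :=
  continuous_pi fun n =>
    (continuous_of_discreteTopology (f := fun b : Bool => xor b (decide (n ∈ F)))).comp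
      (continuous_apply n)

lemma isOpenMap_flipOn (F : Finset ℕ) : IsOpenMap (flipOn F) :=
  IsOpenMap.of_inverse (continuous_flipOn F) (flipOn_involutive F).leftInverse
    (flipOn_involutive F).rightInverse

lemma tendsto_flipOn_residual (F : Finset ℕ) :
    Tendsto (flipOn F) (residual Cantor) (residual Cantor) :=
  tendsto_residual_of_isOpenMap (continuous_flipOn F) (isOpenMap_flipOn F)

lemma tendsto_flipOn_singleton (x : Cantor) :
    Tendsto (fun n => flipOn {n} x) atTop (𝓝 x) := by
  refine tendsto_pi_nhds.2 fun k => tendsto_nhds_of_eventually_eq ?_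
  filter_upwards [eventually_gt_atTop k] with n hn
  simp [flipOn, hn.ne]

lemma exists_flipOn_eq_of_simRel {x y : Cantor} (h : simRel x y) :
    ∃ F : Finset ℕ, flipOn F x = y := by
  have hfin : {n : ℕ | x n ≠ y n}.Finite := Set.encard_lt_top_iff.1 h
  refine ⟨hfin.toFinset, funext fun n => ?_⟩
  cases hx : x n <;> cases hy : y n <;> simp [flipOn, hx, hy]

lemma hd_flipOn_singleton (x : Cantor) (n : ℕ) : hd x (flipOn {n} x) = 1 := by
  have : {k : ℕ | x k ≠ flipOn {n} x k} = {n} := by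
    ext k
    by_cases hk : k = n <;> simp [flipOn, hk]
  rw [hd, this, Set.encard_singleton]

lemma IsThin.flipOn_singleton_notMem {T : Set Cantor} (hT : IsThin T) {x : Cantor} (hx : x ∈ T)
    (n : ℕ) : flipOn {n} x ∉ T := by
  intro hy
  have hne : x ≠ flipOn {n} x := fun h => by simpa [flipOn] using congrFun h n
  have := hT x hx _ hy hne
  rw [hd_flipOn_singleton] at this
  exact absurd this (by decide)

/-- A thin set with the Baire property is meager. -/
lemma IsThin.compl_mem_residual {T : Set Cantor} (hT : IsThin T) (hb : BaireMeasurableSet T) :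
    Tᶜ ∈ residual Cantor := by
  obtain ⟨U, hU, hTU⟩ := hb.residualEq_isOpen
  rcases U.eq_empty_or_nonempty with rfl | ⟨x, hx⟩
  · filter_upwards [hTU] with y hy hyT
    exact (hy.mp hyT).elim
  · obtain ⟨n, hn⟩ := ((tendsto_flipOn_singleton x).eventually (hU.mem_nhds hx)).exists
    have hres : ∀ᶠ y in residual Cantor, (y ∈ T ↔ y ∈ U) := by
      filter_upwards [hTU] with y hy using Iff.of_eq hy
    obtain ⟨y, ⟨hyU, hyU'⟩, hy, hy'⟩ := (dense_of_mem_residual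
      (hres.and ((tendsto_flipOn_residual {n}).eventually hres))).inter_open_nonempty
      (U ∩ flipOn {n} ⁻¹' U) (hU.inter (hU.preimage (continuous_flipOn {n}))) ⟨x, hx, hn⟩
    exact (hT.flipOn_singleton_notMem (hy.2 hyU) n (hy'.2 hyU')).elim

/-- Theorem: a thin set meeting every `∼`-class is not Borel. -/
theorem not_borel_of_thin_meets_every_class (T : Set Cantor) (hthin : IsThin T)
    (hmeet : ∀ z : Cantor, (T ∩ simClass z).Nonempty) :
    ¬ MeasurableSet[borel Cantor] T := by
  intro hB
  rw [← BorelSpace.measurable_eq (α := Cantor)] at hB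
  have hmeager := hthin.compl_mem_residual hB.baireMeasurableSet
  have hall : ∀ᶠ z in residual Cantor, ∀ F : Finset ℕ, flipOn F z ∈ Tᶜ :=
    eventually_countable_forall.2 fun F => tendsto_flipOn_residual F hmeager
  obtain ⟨z, hz⟩ := (dense_of_mem_residual hall).nonempty
  obtain ⟨t, htT, hzt⟩ := hmeet z
  obtain ⟨F, rfl⟩ := exists_flipOn_eq_of_simRel hzt
  exact hz F htT
end

section
/- There exist two disjoint sets T₀, T₁ ⊆ ℤ₂^ω such that T₀ ∪ T₁ = ℤ₂^ω, both T₀ and T₁ are thin, and neither T₀ nor T₁ is a Borel subset of the Cantor cube. -/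
open MeasureTheory

/-- Flipping the `n`-th coordinate of a binary sequence. -/
def flipCoord (n : ℕ) (x : Cantor) : Cantor := Function.update x n (!x n)

theorem flipCoord_involutive (n : ℕ) : Function.Involutive (flipCoord n) := by
  intro x
  simp [flipCoord]

theorem continuous_flipCoord (n : ℕ) : Continuous (flipCoord n) :=
  continuous_id.update n ((continuous_of_discreteTopology (f := not)).comp (continuous_apply n))

theorem isOpenMap_flipCoord (n : ℕ) : IsOpenMap (flipCoord n) :=
  (Homeomorph.mk (flipCoord_involutive n).toPerm (continuous_flipCoord n)
    (continuous_flipCoord n)).isOpenMap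

open Filter Topology in
theorem tendsto_flipCoord (x : Cantor) : Tendsto (fun n => flipCoord n x) atTop (𝓝 x) := by
  rw [tendsto_pi_nhds]
  intro i
  refine tendsto_const_nhds.congr' ?_
  filter_upwards [eventually_gt_atTop i] with n hn
  simp [flipCoord, Function.update_of_ne hn.ne]

/-- Two sequences at Hamming distance less than `2` are equal or differ by one flip. -/
theorem eq_flipCoord_of_hd_lt_two {x y : Cantor} (hne : x ≠ y) (h : hd x y < 2) :
    ∃ n, y = flipCoord n x := by
  have hle : hd x y ≤ 1 := Order.le_of_lt_add_one (by rwa [one_add_one_eq_two])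
  obtain ⟨n, hn⟩ := Function.ne_iff.mp hne
  refine ⟨n, funext fun i => ?_⟩
  rcases eq_or_ne i n with rfl | hi
  · simpa [flipCoord] using Bool.eq_not.mpr hn.symm
  · rw [flipCoord, Function.update_of_ne hi]
    by_contra hxy
    exact hi (Set.encard_le_one_iff.mp hle i n (Ne.symm hxy) hn)

theorem isThin_of_flipCoord_notMem {T : Set Cantor}
    (hT : ∀ n, ∀ x ∈ T, flipCoord n x ∉ T) : IsThin T := by
  intro x hx y hy hne
  by_contra h
  obtain ⟨n, rfl⟩ := eq_flipCoord_of_hd_lt_two hne (not_le.mp h)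
  exact hT n x hx hy

open Filter Topology in
/-- A set that every coordinate flip maps onto its complement fails the Baire property. -/
theorem not_measurableSet_of_flipCoord_mem_iff {T : Set Cantor}
    (hT : ∀ n x, flipCoord n x ∈ T ↔ x ∉ T) : ¬ MeasurableSet[borel Cantor] T := by
  intro hm
  borelize Cantor
  obtain ⟨U, hU, hTU⟩ := hm.residualEq_isOpen
  have hflip (n : ℕ) : ∀ᶠ x in residual Cantor, (flipCoord n x ∈ T ↔ flipCoord n x ∈ U) :=
    (tendsto_residual_of_isOpenMap (continuous_flipCoord n) (isOpenMap_flipCoord n)).eventually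
      hTU.mem_iff
  have hUempty : U = ∅ := by
    by_contra hne
    obtain ⟨x, hx⟩ := Set.nonempty_iff_ne_empty.mpr hne
    obtain ⟨n, hn⟩ := ((tendsto_flipCoord x).eventually (hU.mem_nhds hx)).exists
    have hV : IsOpen (U ∩ flipCoord n ⁻¹' U) := hU.inter (hU.preimage (continuous_flipCoord n))
    have hd : Dense (U ∩ flipCoord n ⁻¹' U)ᶜ := by
      refine dense_of_mem_residual ?_
      filter_upwards [hTU.mem_iff, hflip n] with y h₁ h₂ h₃
      exact (hT n y).mp (h₂.mpr h₃.2) (h₁.mpr h₃.1)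
    obtain ⟨y, hy, hy'⟩ := hd.inter_open_nonempty _ hV ⟨x, hx, hn⟩
    exact hy' hy
  subst hUempty
  have hfalse : (∅ : Set Cantor) ∈ residual Cantor := by
    filter_upwards [hTU.mem_iff, hflip 0] with y h₁ h₂
    have := hT 0 y
    simp_all
  exact (dense_of_mem_residual hfalse).nonempty.ne_empty rfl

/-- Being at finite Hamming distance, as a setoid. -/
def finiteDiffSetoid : Setoid Cantor where
  r x y := {n | x n ≠ y n}.Finite
  iseqv :=
    { refl := fun x => by simp
      symm := fun {x y} h => by simpa only [ne_comm] using h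
      trans := fun {x y z} h₁ h₂ => (h₁.union h₂).subset fun n hn => by
        by_contra h
        simp_all }

/-- The sequences at even Hamming distance from the chosen representative of their class. -/
def evenSet : Set Cantor :=
  {x | Even {n | x n ≠ (Quotient.mk finiteDiffSetoid x).out n}.ncard}

theorem flipCoord_mem_evenSet_iff (n : ℕ) (x : Cantor) :
    flipCoord n x ∈ evenSet ↔ x ∉ evenSet := by
  have hq : Quotient.mk finiteDiffSetoid (flipCoord n x) = Quotient.mk finiteDiffSetoid x := by
    refine Quotient.sound ((Set.finite_singleton n).subset fun i hi => ?_)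
    by_contra h
    exact hi (Function.update_of_ne h _ _)
  have hfin : {i | x i ≠ (Quotient.mk finiteDiffSetoid x).out i}.Finite :=
    finiteDiffSetoid.symm (Quotient.mk_out (s := finiteDiffSetoid) x)
  simp only [evenSet, Set.mem_ofPred_eq, hq]
  generalize (Quotient.mk finiteDiffSetoid x).out = z at hfin
  by_cases hn : x n = z n
  · have : {i | flipCoord n x i ≠ z i} = insert n {i | x i ≠ z i} := by
      ext i
      rcases eq_or_ne i n with rfl | hi
      · simp [flipCoord, hn]
      · simp [flipCoord, hi]
    rw [this, Set.ncard_insert_of_notMem (by simpa using hn) hfin, Nat.even_add_one]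
  · have : {i | x i ≠ z i} = insert n {i | flipCoord n x i ≠ z i} := by
      ext i
      rcases eq_or_ne i n with rfl | hi
      · simp [hn]
      · simp [flipCoord, hi]
    have hfin' := hfin
    rw [this] at hfin' ⊢
    rw [Set.ncard_insert_of_notMem (by simpa [flipCoord] using hn)
      (hfin'.subset (Set.subset_insert _ _)), Nat.even_add_one, not_not]

/-- There exist two disjoint non-Borel thin sets covering the Cantor cube. -/
theorem exists_partition_into_two_thin_non_borel :
    ∃ T₀ T₁ : Set Cantor, Disjoint T₀ T₁ ∧ T₀ ∪ T₁ = Set.univ ∧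
      IsThin T₀ ∧ IsThin T₁ ∧
      ¬ MeasurableSet[borel Cantor] T₀ ∧ ¬ MeasurableSet[borel Cantor] T₁ := by
  have h := flipCoord_mem_evenSet_iff
  have hc (n : ℕ) (x : Cantor) : flipCoord n x ∈ evenSetᶜ ↔ x ∉ evenSetᶜ :=
    not_congr (h n x)
  exact ⟨evenSet, evenSetᶜ, disjoint_compl_right, Set.union_compl_self _,
    isThin_of_flipCoord_notMem fun n x hx hx' => (h n x).mp hx' hx,
    isThin_of_flipCoord_notMem fun n x hx hx' => (hc n x).mp hx' hx,
    not_measurableSet_of_flipCoord_mem_iff h, not_measurableSet_of_flipCoord_mem_iff hc⟩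
end

section
/- Let T₀, T₁ ⊆ ℤ₂^ω be two thin sets such that T₀ ∪ T₁ = ℤ₂^ω. Then T₀ and T₁ are disjoint and both are xor-sets. -/
/-- The relation `x ≈ y` iff `hd x y` is finite and even. -/
def apRel (x y : Cantor) : Prop := ∃ m : ℕ, Even m ∧ hd x y = (m : ℕ∞)

/-- The `≈`-equivalence class of `x`. -/
def apClass (x : Cantor) : Set Cantor := {y | apRel x y}

/-- `x^{#n}`: the sequence `x` with the `n`-th bit flipped. -/
def flipAt (x : Cantor) (n : ℕ) : Cantor := fun k => if k = n then !x k else x k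

/-- `XS` is a xor-set if for every `n` and `x`: `x ∈ XS ↔ x^{#n} ∉ XS`. -/
def IsXorSet (XS : Set Cantor) : Prop := ∀ (n : ℕ) (x : Cantor), x ∈ XS ↔ flipAt x n ∉ XS

theorem hd_flipAt (x : Cantor) (n : ℕ) : hd x (flipAt x n) = 1 := by
  have h : {k : ℕ | x k ≠ flipAt x n k} = {n} := by
    ext k
    by_cases hk : k = n <;> simp [flipAt, hk]
  rw [hd, h, Set.encard_singleton]

theorem flipAt_ne (x : Cantor) (n : ℕ) : x ≠ flipAt x n := by
  intro h
  simpa [flipAt] using congrFun h n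

theorem IsThin.flipAt_notMem {T : Set Cantor} (hT : IsThin T) {x : Cantor} (hx : x ∈ T) (n : ℕ) :
    flipAt x n ∉ T := by
  intro hy
  have h := hT x hx _ hy (flipAt_ne x n)
  rw [hd_flipAt] at h
  exact absurd h (by decide)

theorem IsThin.isXorSet_of_union_eq_univ {S T : Set Cantor} (hS : IsThin S) (hT : IsThin T)
    (h : S ∪ T = Set.univ) : IsXorSet S := by
  have hcov : ∀ x, x ∈ S ∨ x ∈ T := Set.eq_univ_iff_forall.mp h
  exact fun n x => ⟨fun hx => hS.flipAt_notMem hx n, fun hy =>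
    (hcov x).resolve_right fun hx => hT.flipAt_notMem hx n ((hcov _).resolve_left hy)⟩

/-- If two thin sets cover the Cantor cube, they are disjoint xor-sets. -/
theorem thin_cover_disjoint_xorSets (T₀ T₁ : Set Cantor)
    (h₀ : IsThin T₀) (h₁ : IsThin T₁) (hcov : T₀ ∪ T₁ = Set.univ) :
    Disjoint T₀ T₁ ∧ IsXorSet T₀ ∧ IsXorSet T₁ := by
  refine ⟨Set.disjoint_left.mpr fun x hx₀ hx₁ => ?_, h₀.isXorSet_of_union_eq_univ h₁ hcov,
    h₁.isXorSet_of_union_eq_univ h₀ (Set.union_comm T₀ T₁ ▸ hcov)⟩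
  exact (Set.eq_univ_iff_forall.mp hcov (flipAt x 0)).elim
    (h₀.flipAt_notMem hx₀ 0) (h₁.flipAt_notMem hx₁ 0)
end

section
/- Let k, n ∈ ℕ with 3 ≤ k ≤ n, and let {T_i}_{i ∈ I} be a partition of the finite cube ℤ₂ⁿ (binary words of length n) into sets each of which is k-thin. Then the number of parts satisfies |I| ≥ C(n, ⌊(k−1)/2⌋), the binomial coefficient n choose ⌊(k−1)/2⌋. -/
/-- The Hamming distance on the finite cube `ℤ₂ⁿ`. -/
def hdFin {n : ℕ} (x y : Fin n → Bool) : ℕ :=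
  (Finset.univ.filter fun i => x i ≠ y i).card

/-- `T ⊆ ℤ₂ⁿ` is `k`-thin: `hd x y ≥ k` for all distinct `x, y ∈ T`. -/
def IsKThinFin {n : ℕ} (k : ℕ) (T : Set (Fin n → Bool)) : Prop :=
  ∀ x ∈ T, ∀ y ∈ T, x ≠ y → k ≤ hdFin x y

/-- The characteristic words of two finsets are at Hamming distance at most the sum of
the cardinalities. -/
theorem hdFin_decide_mem_le {n : ℕ} (s t : Finset (Fin n)) :
    hdFin (fun j => decide (j ∈ s)) (fun j => decide (j ∈ t)) ≤ s.card + t.card := by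
  refine (Finset.card_le_card fun j hj => ?_).trans (Finset.card_union_le s t)
  simp only [Finset.mem_filter, Finset.mem_univ, true_and, ne_eq, decide_eq_decide] at hj
  rw [Finset.mem_union]
  tauto

/-- Any partition of `ℤ₂ⁿ` into `k`-thin sets (`3 ≤ k ≤ n`) has at least
`C(n, ⌊(k-1)/2⌋)` parts. -/
theorem parts_lower_bound_of_kThin_partition {k n : ℕ} (hk : 3 ≤ k) (hkn : k ≤ n)
    {ι : Type*} (T : ι → Set (Fin n → Bool))
    (hthin : ∀ i, IsKThinFin k (T i))
    (hdisj : Pairwise (Function.onFun Disjoint T))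
    (hcover : ⋃ i, T i = Set.univ) :
    (n.choose ((k - 1) / 2) : Cardinal) ≤ Cardinal.mk ι := by
  choose f hf using fun x => Set.mem_iUnion.1 (hcover ▸ Set.mem_univ x : x ∈ ⋃ i, T i)
  let g : Finset.powersetCard ((k - 1) / 2) (Finset.univ : Finset (Fin n)) → ι :=
    fun s => f fun j => decide (j ∈ s.1)
  have hg : Function.Injective g := by
    rintro ⟨s, hs⟩ ⟨t, ht⟩ hst
    have hcs := (Finset.mem_powersetCard.1 hs).2
    have hct := (Finset.mem_powersetCard.1 ht).2
    by_contra hne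
    have hwords : (fun j => decide (j ∈ s)) ≠ fun j => decide (j ∈ t) := fun h =>
      hne <| Subtype.ext <| Finset.ext fun j => decide_eq_decide.1 (congrFun h j)
    have hfar := hthin _ _ (hf fun j => decide (j ∈ s)) _
      ((congrArg T hst).symm ▸ hf fun j => decide (j ∈ t)) hwords
    have hnear := hdFin_decide_mem_le s t
    lia
  simpa using Cardinal.lift_mk_le_lift_mk_of_injective hg
end

section
/- Let k ∈ ℕ with k ≥ 3. Then there is no partition of the Cantor cube ℤ₂^ω into finitely many k-thin sets; equivalently, every partition of ℤ₂^ω into k-thin sets has infinitely many parts. -/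
/-- `T` is `k`-thin: `hd x y ≥ k` for all distinct `x, y ∈ T`. -/
def IsKThin (k : ℕ) (T : Set Cantor) : Prop :=
  ∀ x ∈ T, ∀ y ∈ T, x ≠ y → (k : ℕ∞) ≤ hd x y

/-- The sequence whose only `true` entry is at position `n`. -/
def unitSeq (n : ℕ) : Cantor := fun m => decide (m = n)

theorem unitSeq_injective : Function.Injective unitSeq := fun a b h => by
  simpa [unitSeq] using congrFun h a

theorem hd_unitSeq_le (a b : ℕ) : hd (unitSeq a) (unitSeq b) ≤ 2 := by
  have hsub : {n | unitSeq a n ≠ unitSeq b n} ⊆ {a, b} := fun m hm => by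
    by_contra h
    simp_all [unitSeq]
  calc hd (unitSeq a) (unitSeq b) ≤ ({a, b} : Set ℕ).encard := Set.encard_le_encard hsub
    _ ≤ ({b} : Set ℕ).encard + 1 := Set.encard_insert_le _ _
    _ = 2 := by rw [Set.encard_singleton, one_add_one_eq_two]

/-- A `k`-thin set with `k ≥ 3` contains at most one unit sequence. -/
theorem IsKThin.eq_of_unitSeq_mem {k : ℕ} (hk : 3 ≤ k) {S : Set Cantor} (hS : IsKThin k S)
    {a b : ℕ} (ha : unitSeq a ∈ S) (hb : unitSeq b ∈ S) : a = b := by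
  by_contra hab
  have h : (k : ℕ∞) ≤ (2 : ℕ) :=
    (hS _ ha _ hb (unitSeq_injective.ne hab)).trans (hd_unitSeq_le a b)
  have := Nat.cast_le.mp h
  omega

/-- For `k ≥ 3`, every partition of the Cantor cube into `k`-thin sets has
infinitely many parts; in particular there is no such finite partition. -/
theorem no_finite_partition_into_kThin (k : ℕ) (hk : 3 ≤ k)
    {ι : Type*} (T : ι → Set Cantor)
    (hthin : ∀ i, IsKThin k (T i))
    (hdisj : Pairwise (Function.onFun Disjoint T))
    (hcover : ⋃ i, T i = Set.univ) :
    Infinite ι := by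
  have hmem : ∀ n, ∃ i, unitSeq n ∈ T i := fun n =>
    Set.mem_iUnion.mp (hcover ▸ Set.mem_univ _)
  choose f hf using hmem
  exact Infinite.of_injective f fun a b hab =>
    (hthin (f b)).eq_of_unitSeq_mem hk (hab ▸ hf a) (hf b)
end
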